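/- Let λ > 0, T > 0, let 0 < ε < 1, and set Δ = ε·√(2λ/T). Then the Kullback–Leibler divergence between the Poisson distribution with mean λT and the Poisson distribution with mean (λ + Δ)T satisfies D(P_{λT} ‖ P_{(λ+Δ)T}) ≤ 2ε², and hence √(D(P_{λT} ‖ P_{(λ+Δ)T})/2) ≤ ε. -/

import Mathlib

/-- The Poisson probability mass function with mean `m`: `P(n) = e^{-m} mⁿ / n!`. -/
noncomputable def poissonPMF (m : ℝ) (n : ℕ) : ℝ :=
  Real.exp (-m) * m ^ n / n.factorial

/-- Kullback–Leibler divergence between two pmfs on ℕ: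
`D(P ‖ Q) = ∑ₙ P(n) log(P(n)/Q(n))`. -/
noncomputable def klDivPMF (P Q : ℕ → ℝ) : ℝ :=
  ∑' n : ℕ, P n * Real.log (P n / Q n)

theorem hasSum_poissonPMF {m : ℝ} (hm : 0 ≤ m) : HasSum (poissonPMF m) 1 :=
  ProbabilityTheory.hasSum_one_poissonMeasure ⟨m, hm⟩

theorem succ_mul_poissonPMF_succ (m : ℝ) (n : ℕ) :
    ((n + 1 : ℕ) : ℝ) * poissonPMF m (n + 1) = m * poissonPMF m n := by
  have h : ((n.factorial : ℕ) : ℝ) ≠ 0 := by positivity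
  simp only [poissonPMF, Nat.factorial_succ]
  push_cast
  field_simp
  ring

/-- The mean of the Poisson distribution. -/
theorem hasSum_natCast_mul_poissonPMF {m : ℝ} (hm : 0 ≤ m) :
    HasSum (fun n : ℕ => (n : ℝ) * poissonPMF m n) m := by
  rw [← hasSum_nat_add_iff' 1]
  simpa [succ_mul_poissonPMF_succ, -Nat.cast_add]
    using (hasSum_poissonPMF hm).mul_left m

theorem log_poissonPMF_div {a b : ℝ} (ha : 0 < a) (hb : 0 < b) (n : ℕ) :
    Real.log (poissonPMF a n / poissonPMF b n) = (b - a) + n * Real.log (a / b) := by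
  have h : poissonPMF a n / poissonPMF b n = Real.exp (b - a) * (a / b) ^ n := by
    have hf : ((n.factorial : ℕ) : ℝ) ≠ 0 := by positivity
    rw [poissonPMF, poissonPMF, div_pow, show b - a = -a - -b by ring, Real.exp_sub]
    field_simp
  rw [h, Real.log_mul (by positivity) (by positivity), Real.log_exp, Real.log_pow]

theorem klDivPMF_poissonPMF {a b : ℝ} (ha : 0 < a) (hb : 0 < b) :
    klDivPMF (poissonPMF a) (poissonPMF b) = (b - a) + a * Real.log (a / b) := by
  have h := ((hasSum_poissonPMF ha.le).mul_right (b - a)).add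
    ((hasSum_natCast_mul_poissonPMF ha.le).mul_right (Real.log (a / b)))
  rw [one_mul] at h
  rw [klDivPMF, ← h.tsum_eq]
  refine tsum_congr fun n => ?_
  rw [log_poissonPMF_div ha hb]
  ring

/-- The divergence between two Poisson distributions is at most `(b - a)² / b`. -/
theorem klDivPMF_poissonPMF_le {a b : ℝ} (ha : 0 < a) (hb : 0 < b) :
    klDivPMF (poissonPMF a) (poissonPMF b) ≤ (b - a) ^ 2 / b := by
  rw [klDivPMF_poissonPMF ha hb]
  calc (b - a) + a * Real.log (a / b)
      ≤ (b - a) + a * (a / b - 1) := by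
        gcongr
        exact Real.log_le_sub_one_of_pos (by positivity)
    _ = (b - a) ^ 2 / b := by
        field_simp
        ring

/-- For `λ, T > 0`, `0 < ε < 1` and `Δ = ε √(2λ/T)`, one has
`D(P_{λT} ‖ P_{(λ+Δ)T}) ≤ 2ε²` and hence `√(D(P_{λT} ‖ P_{(λ+Δ)T})/2) ≤ ε`. -/
theorem klDiv_poisson_covert (lam T ε Δ : ℝ) (hlam : 0 < lam) (hT : 0 < T)
    (hε0 : 0 < ε) (hε1 : ε < 1) (hΔ : Δ = ε * Real.sqrt (2 * lam / T)) :
    klDivPMF (poissonPMF (lam * T)) (poissonPMF ((lam + Δ) * T)) ≤ 2 * ε ^ 2 ∧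
    Real.sqrt (klDivPMF (poissonPMF (lam * T)) (poissonPMF ((lam + Δ) * T)) / 2) ≤ ε := by
  have hΔ0 : 0 ≤ Δ := by rw [hΔ]; positivity
  have hΔ2 : Δ ^ 2 = ε ^ 2 * (2 * lam / T) := by
    rw [hΔ, mul_pow, Real.sq_sqrt (by positivity)]
  have hle : klDivPMF (poissonPMF (lam * T)) (poissonPMF ((lam + Δ) * T)) ≤ 2 * ε ^ 2 :=
    calc klDivPMF (poissonPMF (lam * T)) (poissonPMF ((lam + Δ) * T))
        ≤ ((lam + Δ) * T - lam * T) ^ 2 / ((lam + Δ) * T) :=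
          klDivPMF_poissonPMF_le (by positivity) (by positivity)
      _ ≤ ((lam + Δ) * T - lam * T) ^ 2 / (lam * T) := by
          gcongr
          linarith
      _ = Δ ^ 2 * (T / lam) := by
          field_simp
          ring
      _ = 2 * ε ^ 2 := by
          rw [hΔ2]
          field_simp
  exact ⟨hle, Real.sqrt_le_iff.mpr ⟨hε0.le, by linarith⟩⟩
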